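/- Let S be a nonempty finite set, let P : S × S → ℝ be a row-stochastic transition matrix, and let π be a probability distribution on S satisfying detailed balance with respect to P. Fix k ≥ 1, ε > 0, and a label function ω : S → ℝ. For σ ∈ S, let p(σ) be the probability, under the measure on paths (x_0,…,x_k) with x_0 = σ given by ∏_{i=0}^{k-1} P(x_i, x_{i+1}), that #{ i ∈ {0,…,k} : ω(x_i) ≤ ω(x_0) } ≤ ε(k+1). Then ∑_{σ ∈ S} π(σ)·p(σ)² ≤ 2ε. -/

import Mathlib

open scoped Classical BigOperators

/-- Expectation of `g (x₁, …, xₙ)` for the chain with transition matrix `P` started at `σ`. -/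
noncomputable def pathExp {S : Type*} [Fintype S] (P : S → S → ℝ) :
    ℕ → S → (List S → ℝ) → ℝ
  | 0, _, g => g []
  | n + 1, σ, g => ∑ y, P σ y * pathExp P n y (fun l => g (y :: l))

section PathExp

variable {S : Type*} [Fintype S] {P : S → S → ℝ}

theorem pathExp_mono (hP0 : ∀ x y, 0 ≤ P x y) (n : ℕ) (σ : S) {f g : List S → ℝ}
    (h : ∀ l, l.length = n → f l ≤ g l) : pathExp P n σ f ≤ pathExp P n σ g := by
  induction n generalizing σ f g with
  | zero => exact h [] rfl
  | succ n ih =>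
    exact Finset.sum_le_sum fun y _ =>
      mul_le_mul_of_nonneg_left (ih y fun l hl => h (y :: l) (by simp [hl])) (hP0 σ y)

theorem pathExp_const (hP1 : ∀ x, ∑ y, P x y = 1) (n : ℕ) (σ : S) (c : ℝ) :
    pathExp P n σ (fun _ => c) = c := by
  induction n generalizing σ with
  | zero => rfl
  | succ n ih => simp [pathExp, ih, ← Finset.sum_mul, hP1]

theorem pathExp_const_mul (n : ℕ) (σ : S) (c : ℝ) (g : List S → ℝ) :
    pathExp P n σ (fun l => c * g l) = c * pathExp P n σ g := by
  induction n generalizing σ g with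
  | zero => rfl
  | succ n ih =>
    simp only [pathExp, ih, Finset.mul_sum]
    exact Finset.sum_congr rfl fun y _ => by ring

theorem pathExp_sum {ι : Type*} (s : Finset ι) (n : ℕ) (σ : S) (g : ι → List S → ℝ) :
    pathExp P n σ (fun l => ∑ j ∈ s, g j l) = ∑ j ∈ s, pathExp P n σ (g j) := by
  induction n generalizing σ g with
  | zero => rfl
  | succ n ih =>
    simp only [pathExp, ih, Finset.mul_sum]
    exact Finset.sum_comm

theorem pathExp_mul_pathExp (m n : ℕ) (σ : S) (f g : List S → ℝ) :
    pathExp P m σ f * pathExp P n σ g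
      = pathExp P m σ (fun a => pathExp P n σ (fun b => f a * g b)) := by
  simp only [pathExp_const_mul]
  rw [mul_comm, ← pathExp_const_mul]
  simp only [mul_comm]

theorem pathExp_nonneg (hP0 : ∀ x y, 0 ≤ P x y) (n : ℕ) (σ : S) {g : List S → ℝ}
    (hg : ∀ l, 0 ≤ g l) : 0 ≤ pathExp P n σ g := by
  induction n generalizing σ g with
  | zero => exact hg []
  | succ n ih =>
    exact Finset.sum_nonneg fun y _ => mul_nonneg (hP0 σ y) (ih y fun l => hg (y :: l))

theorem pathExp_succ_le (hP0 : ∀ x y, 0 ≤ P x y) (hP1 : ∀ x, ∑ y, P x y = 1)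
    (n : ℕ) (σ : S) {g : List S → ℝ} (hg : ∀ l y, g (l ++ [y]) ≤ g l) :
    pathExp P (n + 1) σ g ≤ pathExp P n σ g := by
  induction n generalizing σ g with
  | zero =>
    calc ∑ y, P σ y * g [y] ≤ ∑ y, P σ y * g [] :=
          Finset.sum_le_sum fun y _ => mul_le_mul_of_nonneg_left (hg [] y) (hP0 σ y)
      _ = g [] := by rw [← Finset.sum_mul, hP1, one_mul]
  | succ n ih =>
    exact Finset.sum_le_sum fun y _ =>
      mul_le_mul_of_nonneg_left (ih y fun l z => hg (y :: l) z) (hP0 σ y)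

theorem pathExp_antitone (hP0 : ∀ x y, 0 ≤ P x y) (hP1 : ∀ x, ∑ y, P x y = 1)
    (σ : S) {g : List S → ℝ} (hg : ∀ l y, g (l ++ [y]) ≤ g l) :
    Antitone fun n => pathExp P n σ g :=
  antitone_nat_of_succ_le fun n => pathExp_succ_le hP0 hP1 n σ hg

/-- A stationary reversible path, seen from its `j`-th vertex, consists of two independent arms. -/
theorem sum_pathExp_arms {π : S → ℝ} (hdb : ∀ x y, π x * P x y = π y * P y x)
    (j m : ℕ) (H : List S → ℝ) :
    ∑ σ, π σ * pathExp P j σ (fun a => pathExp P m σ (fun b => H (a.reverse ++ σ :: b)))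
      = ∑ σ, π σ * pathExp P (j + m) σ (fun b => H (σ :: b)) := by
  induction j generalizing m with
  | zero => simp [pathExp]
  | succ j ih =>
    rw [show j + 1 + m = j + (m + 1) by ring, ← ih (m + 1)]
    simp only [pathExp, pathExp_sum, pathExp_const_mul, Finset.mul_sum]
    rw [Finset.sum_comm]
    refine Finset.sum_congr rfl fun x _ => Finset.sum_congr rfl fun y _ => ?_
    rw [← mul_assoc, ← mul_assoc, hdb]
    simp

theorem sum_prod_eq_pathExp (n : ℕ) (σ : S) (g : List S → ℝ) :
    ∑ x : Fin n → S, (∏ i : Fin n,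
        P ((Fin.cons σ x : Fin (n + 1) → S) i.castSucc) (x i)) * g (List.ofFn x)
      = pathExp P n σ g := by
  induction n generalizing σ g with
  | zero => simp [pathExp]
  | succ n ih =>
    rw [← (Fin.consEquiv fun _ => S).sum_comp, Fintype.sum_prod_type]
    refine Finset.sum_congr rfl fun y _ => ?_
    rw [← ih, Finset.mul_sum]
    refine Finset.sum_congr rfl fun x _ => ?_
    simp [Fin.consEquiv, Fin.prod_univ_succ, List.ofFn_succ, mul_assoc]

end PathExp

theorem card_filter_eq_countP_ofFn {S : Type*} {n : ℕ} (x : Fin n → S) (q : S → Prop) :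
    (Finset.univ.filter fun i => q (x i)).card = (List.ofFn x).countP (fun s => q s) := by
  induction n with
  | zero => simp
  | succ n ih =>
    rw [List.ofFn_succ, List.countP_cons, ← ih, Fin.card_filter_univ_succ]
    by_cases h : q (x 0) <;> simp [h]

theorem sum_range_getD {S : Type*} (f : S → ℝ) (d : S) (L : List S) :
    ∑ j ∈ Finset.range L.length, f (L.getD j d) = (L.map f).sum := by
  induction L with
  | nil => simp
  | cons a L ih => simp [Finset.sum_range_succ', ← ih, add_comm]

theorem sum_map_ite_eq_countP {S : Type*} (q : S → Prop) (L : List S) :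
    (L.map fun s => if q s then (1 : ℝ) else 0).sum = L.countP (fun s => q s) := by
  induction L with
  | nil => simp
  | cons a L ih =>
    by_cases h : q a <;> simp [ih, h, add_comm]

/-- At most `c` entries of a list have rank at most `c`. -/
theorem countP_rank_le {S : Type*} (ω : S → ℝ) (L : List S) {c : ℝ} (hc : 0 ≤ c) :
    (L.countP (fun s => (L.countP (fun t => ω t ≤ ω s) : ℝ) ≤ c) : ℝ) ≤ c := by
  set q : S → Prop := fun s => (L.countP (fun t => ω t ≤ ω s) : ℝ) ≤ c with hq
  by_cases hne : (L.toFinset.filter q).Nonempty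
  · obtain ⟨s, hs, hmax⟩ := Finset.exists_max_image _ ω hne
    simp only [Finset.mem_filter, List.mem_toFinset] at hs hmax
    refine le_trans ?_ hs.2
    exact_mod_cast List.countP_mono_left fun t ht h => by
      simpa using hmax t ⟨ht, by simpa using h⟩
  · rw [List.countP_eq_zero.2]
    · simpa using hc
    · intro s hs h
      exact hne ⟨s, by simpa [hs] using h⟩

/-- Second-moment bound underlying the CFP and CFMP outlier tests: if `π` is a
probability distribution in detailed balance with the row-stochastic transition
matrix `P`, and `p σ` is the probability that `σ` is an `ε`-outlier of a length-`k`
trajectory of the chain started at `σ`, then `E_π[p²] ≤ 2 ε`. -/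
theorem outlier_second_moment_bound {S : Type*} [Fintype S] [Nonempty S]
    (P : S → S → ℝ) (hP0 : ∀ x y, 0 ≤ P x y) (hP1 : ∀ x, ∑ y, P x y = 1)
    (π : S → ℝ) (hπ0 : ∀ x, 0 ≤ π x) (hπ1 : ∑ x, π x = 1)
    (hdb : ∀ x y, π x * P x y = π y * P y x)
    (k : ℕ) (hk : 1 ≤ k) (ε : ℝ) (hε : 0 < ε) (ω : S → ℝ)
    (p : S → ℝ)
    (hp : ∀ σ : S, p σ =
      ∑ x ∈ Finset.univ.filter (fun x : Fin (k + 1) → S =>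
          x 0 = σ ∧
          ((Finset.univ.filter (fun i : Fin (k + 1) => ω (x i) ≤ ω (x 0))).card : ℝ)
            ≤ ε * (k + 1)),
        ∏ i : Fin k, P (x i.castSucc) (x i.succ)) :
    ∑ σ : S, π σ * (p σ) ^ 2 ≤ 2 * ε := by
  set M : ℝ := ε * (k + 1) with hM
  have hM0 : 0 ≤ M := by positivity
  obtain ⟨d⟩ := ‹Nonempty S›
  let r : S → List S → ℝ := fun σ l =>
    if (1 + l.countP (fun s => ω s ≤ ω σ) : ℝ) ≤ M then 1 else 0
  let H : ℕ → List S → ℝ := fun j L =>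
    if (L.countP (fun s => ω s ≤ ω (L.getD j d)) : ℝ) ≤ 2 * M then 1 else 0
  have hr0 : ∀ σ l, 0 ≤ r σ l := fun σ l => by
    dsimp only [r]; split_ifs <;> norm_num
  have hr : ∀ σ l y, r σ (l ++ [y]) ≤ r σ l := fun σ l y => by
    dsimp only [r]
    rw [List.countP_append]
    split_ifs with h1 h2
    · rfl
    · have h0 : (0 : ℝ) ≤ List.countP (fun s => decide (ω s ≤ ω σ)) [y] := Nat.cast_nonneg _
      push_cast at h1
      linarith
    · norm_num
    · rfl
  have hp' : ∀ σ, p σ = pathExp P k σ (r σ) := fun σ => by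
    rw [hp, ← sum_prod_eq_pathExp, Finset.sum_filter, ← (Fin.consEquiv fun _ => S).sum_comp,
      Fintype.sum_prod_type, Finset.sum_eq_single σ]
    · refine Finset.sum_congr rfl fun x _ => ?_
      rw [card_filter_eq_countP_ofFn _ (fun s => ω s ≤ _)]
      simp [Fin.consEquiv, r, List.ofFn_succ, add_comm]
    · intro b _ hb
      simp [Fin.consEquiv, hb]
    · simp
  have hsq : ∀ j ≤ k, ∀ σ, p σ ^ 2 ≤
      pathExp P j σ (fun a => pathExp P (k - j) σ (fun b => H j (a.reverse ++ σ :: b))) := by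
    intro j hj σ
    have h1 : p σ ≤ pathExp P j σ (r σ) := hp' σ ▸ pathExp_antitone hP0 hP1 σ (hr σ) hj
    have h2 : p σ ≤ pathExp P (k - j) σ (r σ) :=
      hp' σ ▸ pathExp_antitone hP0 hP1 σ (hr σ) (Nat.sub_le k j)
    have h0 : 0 ≤ p σ := hp' σ ▸ pathExp_nonneg hP0 k σ (hr0 σ)
    calc p σ ^ 2 ≤ pathExp P j σ (r σ) * pathExp P (k - j) σ (r σ) := by
          rw [sq]; exact mul_le_mul h1 h2 h0 (h0.trans h1)
      _ ≤ _ := by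
          rw [pathExp_mul_pathExp]
          refine pathExp_mono hP0 _ _ fun a ha => pathExp_mono hP0 _ _ fun b _ => ?_
          have hget : (a.reverse ++ σ :: b).getD j d = σ := by
            simp [List.getD, ← ha]
          dsimp only [r, H]
          rw [hget]
          simp only [List.countP_append, List.countP_reverse, List.countP_cons, le_refl,
            decide_true, if_true, Nat.cast_add, Nat.cast_one]
          split_ifs <;> first | (exfalso; linarith) | norm_num
  have hH : ∀ σ (b : List S), b.length = k →
      ∑ j ∈ Finset.range (k + 1), H j (σ :: b) ≤ 2 * M := by
    intro σ b hb
    have hlen : k + 1 = (σ :: b).length := by simp [hb]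
    rw [hlen, sum_range_getD (fun t => if ((σ :: b).countP (fun s => ω s ≤ ω t) : ℝ) ≤ 2 * M
      then 1 else 0), sum_map_ite_eq_countP]
    exact countP_rank_le ω _ (by positivity)
  have hk1 : (0 : ℝ) < k + 1 := by positivity
  refine le_of_mul_le_mul_left ?_ hk1
  calc ((k : ℝ) + 1) * ∑ σ, π σ * p σ ^ 2
      = ∑ j ∈ Finset.range (k + 1), ∑ σ, π σ * p σ ^ 2 := by simp
    _ ≤ ∑ j ∈ Finset.range (k + 1), ∑ σ, π σ * pathExp P k σ (fun b => H j (σ :: b)) := by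
        refine Finset.sum_le_sum fun j hj => ?_
        have hj : j ≤ k := Nat.lt_succ_iff.1 (Finset.mem_range.1 hj)
        have := sum_pathExp_arms hdb j (k - j) (H j)
        rw [Nat.add_sub_cancel' hj] at this
        rw [← this]
        exact Finset.sum_le_sum fun σ _ => mul_le_mul_of_nonneg_left (hsq j hj σ) (hπ0 σ)
    _ = ∑ σ, π σ * pathExp P k σ (fun b => ∑ j ∈ Finset.range (k + 1), H j (σ :: b)) := by
        rw [Finset.sum_comm]
        simp only [pathExp_sum, Finset.mul_sum]
    _ ≤ ∑ σ, π σ * (2 * M) := by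
        refine Finset.sum_le_sum fun σ _ => mul_le_mul_of_nonneg_left ?_ (hπ0 σ)
        exact (pathExp_mono hP0 k σ (hH σ)).trans_eq (pathExp_const hP1 k σ _)
    _ = (k + 1) * (2 * ε) := by
        rw [← Finset.sum_mul, hπ1, hM]; ring
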